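/- arXiv:2102.11727 — 4 statements merged into one kernel-verified Lean document; each statement's English description precedes it below -/
import Mathlib

section
/- Let f = (f₁,…,f_q) be a tuple of real homogeneous polynomials in n+1 variables with deg fᵢ = dᵢ, and let v ∈ ℝ^{n+1}. Then for every x in the unit sphere S^n of ℝ^{n+1} and every index i, (1/dᵢ)·|D̄ₓfᵢ(v)| ≤ ‖f‖∞·‖v‖₂, where D̄ₓfᵢ(v) is the directional derivative of fᵢ at x in direction v. Equivalently, the real L∞-norm of the polynomial tuple (Δ⁻¹D̄_Xf)(v) is at most ‖f‖∞·‖v‖₂. -/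
open MvPolynomial

noncomputable def vnorm {m : ℕ} (v : Fin m → ℝ) : ℝ := Real.sqrt (∑ j, v j ^ 2)

noncomputable def polySupNorm {n q : ℕ} (f : Fin q → MvPolynomial (Fin (n + 1)) ℝ) : ℝ :=
  ⨆ x : {x : Fin (n + 1) → ℝ // vnorm x = 1}, ⨆ i : Fin q, |eval x.1 (f i)|

section KelloggAux
open scoped Polynomial
open Polynomial (eval_eq_sum_range' derivative_monomial eval_finsetSum)
lemma root_sum {d : ℕ} (hd : 1 ≤ d) {ω ζ η : ℂ} (hω : IsPrimitiveRoot ω d) (r : ℕ) (h : ¬ d ∣ r) :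
    ∑ j ∈ Finset.range d, (ζ * ω ^ j) ^ r = 0 := by
  have h1 : ω ^ r ≠ 1 := fun h' => h (hω.dvd_of_pow_eq_one r h')
  have h2 := mul_geom_sum (ω ^ r) d
  have h3 : (ω ^ r) ^ d = 1 := by rw [← pow_mul, mul_comm, pow_mul, hω.pow_eq_one, one_pow]
  rw [h3, sub_self] at h2
  have h4 := (mul_eq_zero.mp h2).resolve_left (sub_ne_zero.mpr h1)
  calc _ = ζ ^ r * ∑ j ∈ Finset.range d, (ω ^ r) ^ j := by
        rw [Finset.mul_sum]; refine Finset.sum_congr rfl fun j _ => ?_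
        rw [mul_pow, ← pow_mul, ← pow_mul, mul_comm j r]
    _ = 0 := by rw [h4, mul_zero]

lemma node_pow {d : ℕ} {ω ζ η : ℂ} (hω : IsPrimitiveRoot ω d) (hζ : ζ ^ d = η) (j : ℕ) :
    (ζ * ω ^ j) ^ d = η := by
  rw [mul_pow, ← pow_mul, mul_comm j d, pow_mul, hω.pow_eq_one, one_pow, mul_one, hζ]

lemma lemA {d : ℕ} (hd : 1 ≤ d) {ω ζ η : ℂ} (hω : IsPrimitiveRoot ω d) (hζ : ζ ^ d = η)
    (k s : ℕ) (h1 : k * d < s) (h2 : s ≤ (k + 1) * d) :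
    ∑ j ∈ Finset.range d, (ζ * ω ^ j) ^ s * ∑ l ∈ Finset.range d, (ζ * ω ^ j) ^ l
      = d * η ^ (k + 1) := by
  have h2' : (k + 1) * d = k * d + d := by ring
  simp_rw [Finset.mul_sum, ← pow_add]
  rw [Finset.sum_comm, Finset.sum_eq_single ((k + 1) * d - s)]
  · have : s + ((k + 1) * d - s) = d * (k + 1) := by rw [mul_comm d]; omega
    rw [this]
    simp_rw [pow_mul, node_pow hω hζ]
    simp
  · intro l hl hne
    apply root_sum (η := η) hd hω
    rintro ⟨c, hc⟩
    have hl' := Finset.mem_range.mp hl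
    have c1 : k < c := by
      by_contra hh
      have : d * c ≤ d * k := Nat.mul_le_mul_left _ (by omega)
      rw [mul_comm d k] at this; omega
    have c2 : c < k + 2 := by
      by_contra hh
      have : d * (k+2) ≤ d * c := Nat.mul_le_mul_left _ (by omega)
      have : d * (k+2) = (k+1) * d + d := by ring
      omega
    have : c = k + 1 := by omega
    subst this
    rw [mul_comm d] at hc; omega
  · intro h; exfalso; apply h; rw [Finset.mem_range]; omega

lemma lemB {d : ℕ} (hd : 1 ≤ d) {ω ζ η : ℂ} (hω : IsPrimitiveRoot ω d) (hζ : ζ ^ d = η)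
    (p : ℕ) (hp : p ≤ d) :
    ∑ j ∈ Finset.range d, (ζ * ω ^ j) * (∑ l ∈ Finset.range d, (ζ * ω ^ j) ^ l) ^ 2
      * (ζ * ω ^ j) ^ p = d * (η * ((d - p) + η * p)) := by
  have e : ∀ j, (ζ * ω ^ j) * (∑ l ∈ Finset.range d, (ζ * ω ^ j) ^ l) ^ 2
      * (ζ * ω ^ j) ^ p = ∑ m ∈ Finset.range d, (ζ * ω ^ j) ^ (p + 1 + m) *
        ∑ l ∈ Finset.range d, (ζ * ω ^ j) ^ l := by
    intro j
    rw [← Finset.sum_mul]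
    simp_rw [pow_add _ (p+1), ← Finset.mul_sum]
    ring
  simp_rw [e]
  rw [Finset.sum_comm]
  obtain ⟨t, rfl⟩ := Nat.exists_eq_add_of_le' hp
  rw [Finset.sum_range_add (n := t) (m := p)]
  rw [Finset.sum_congr rfl (g := fun _ => ((t + p : ℕ) : ℂ) * η ^ (0 + 1)),
    Finset.sum_congr (s₁ := Finset.range p) rfl (g := fun _ => ((t + p : ℕ) : ℂ) * η ^ (1 + 1))]
  · simp; ring
  · intro m hm; have := Finset.mem_range.mp hm
    exact lemA hd hω hζ 1 _ (by omega) (by omega)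
  · intro m hm; have := Finset.mem_range.mp hm
    exact lemA hd hω hζ 0 _ (by omega) (by omega)

lemma lemC {d : ℕ} (hd : 1 ≤ d) {z η : ℂ} (hz : ‖z‖ = 1) (hη : z ^ d = η) :
    ((‖∑ l ∈ Finset.range d, z ^ l‖ ^ 2 : ℝ) : ℂ) * η = z * (∑ l ∈ Finset.range d, z ^ l) ^ 2 := by
  have hzz : starRingEnd ℂ z * z = 1 := by
    rw [mul_comm, Complex.mul_conj, Complex.normSq_eq_norm_sq, hz]; simp
  have h : starRingEnd ℂ (∑ l ∈ Finset.range d, z ^ l) * η = z * ∑ l ∈ Finset.range d, z ^ l := by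
    rw [map_sum, Finset.sum_mul, ← Finset.sum_range_reflect, Finset.mul_sum]
    refine Finset.sum_congr rfl fun l hl => ?_
    have := Finset.mem_range.mp hl
    have e : d = (d - 1 - l) + (l + 1) := by omega
    rw [← hη, map_pow]
    nth_rw 2 [e]
    rw [pow_add, ← mul_assoc, ← mul_pow, hzz, one_pow]; ring
  have h2 : ((‖∑ l ∈ Finset.range d, z ^ l‖ ^ 2 : ℝ) : ℂ) = (∑ l ∈ Finset.range d, z ^ l) * starRingEnd ℂ (∑ l ∈ Finset.range d, z ^ l) := by
    rw [Complex.mul_conj, Complex.normSq_eq_norm_sq]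
  rw [h2, mul_assoc, h]; ring

lemma malik {d : ℕ} (hd : 1 ≤ d) (P : ℂ[X]) (hP : P.natDegree ≤ d) (M : ℝ)
    (hM : ∀ z : ℂ, ‖z‖ = 1 → ‖P.eval z‖ ≤ M) (η : ℂ) (hη : ‖η‖ = 1) :
    ‖d * P.eval 1 + (η - 1) * P.derivative.eval 1‖ ≤ d * M := by
  have hd0 : d ≠ 0 := by omega
  have hω := Complex.isPrimitiveRoot_exp d hd0
  set ω := Complex.exp (2 * Real.pi * Complex.I / d)
  obtain ⟨ζ, hζ⟩ := IsAlgClosed.exists_pow_nat_eq η (n := d) (by omega)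
  have hη0 : η ≠ 0 := by rintro rfl; simp at hη
  have hn : ∀ j : ℕ, ‖ζ * ω ^ j‖ = 1 := by
    intro j
    have := congrArg norm (node_pow hω hζ j)
    rw [norm_pow, hη] at this
    exact (pow_eq_one_iff_of_nonneg (norm_nonneg _) hd0).mp this
  set W : ℕ → ℝ := fun j => ‖∑ l ∈ Finset.range d, (ζ * ω ^ j) ^ l‖ ^ 2
  have key : ∀ p ≤ d, ∑ j ∈ Finset.range d, (W j : ℂ) * (ζ * ω ^ j) ^ p = d * ((d - p) + η * p) := by
    intro p hp
    apply mul_left_cancel₀ hη0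
    rw [← mul_left_comm (d : ℂ), ← lemB hd hω hζ p hp, Finset.mul_sum]
    refine Finset.sum_congr rfl fun j _ => ?_
    rw [← lemC hd (hn j) (node_pow hω hζ j)]
    simp only [W]; ring
  have hW : ∑ j ∈ Finset.range d, W j = d * d := by
    have := key 0 (by omega)
    simp only [pow_zero, mul_one, Nat.cast_zero, sub_zero, mul_zero, add_zero] at this
    exact_mod_cast this
  have hsum : (d : ℂ) * (d * P.eval 1 + (η - 1) * P.derivative.eval 1)
      = ∑ j ∈ Finset.range d, (W j : ℂ) * P.eval (ζ * ω ^ j) := by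
    have e1 : P.eval 1 = ∑ p ∈ Finset.range (d+1), P.coeff p := by
      rw [eval_eq_sum_range' (n := d+1) (by omega)]; simp
    have e2 : P.derivative.eval 1 = ∑ p ∈ Finset.range (d+1), P.coeff p * p := by
      conv_lhs => rw [P.as_sum_range' (d+1) (by omega)]
      simp [derivative_monomial, eval_finsetSum]
    simp_rw [eval_eq_sum_range' (n := d+1) (show P.natDegree < d + 1 by omega) (ζ * ω ^ _), Finset.mul_sum]
    rw [Finset.sum_comm, e1, e2]
    simp_rw [Finset.mul_sum]
    rw [← Finset.sum_add_distrib, Finset.mul_sum]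
    refine Finset.sum_congr rfl fun p hp => ?_
    simp_rw [mul_left_comm _ (P.coeff p)]
    rw [← Finset.mul_sum, key p (by have := Finset.mem_range.mp hp; omega)]
    ring
  have hdp : (0:ℝ) < d := by exact_mod_cast hd
  have : (d:ℝ) * ‖d * P.eval 1 + (η - 1) * P.derivative.eval 1‖ ≤ d * (d * M) := by
    calc _ = ‖(d : ℂ) * (d * P.eval 1 + (η - 1) * P.derivative.eval 1)‖ := by simp
      _ ≤ ∑ j ∈ Finset.range d, ‖(W j : ℂ) * P.eval (ζ * ω ^ j)‖ := by rw [hsum]; exact norm_sum_le _ _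
      _ ≤ ∑ j ∈ Finset.range d, W j * M := by
        refine Finset.sum_le_sum fun j _ => ?_
        have hw : 0 ≤ W j := by positivity
        rw [norm_mul, Complex.norm_real, Real.norm_of_nonneg hw]
        exact mul_le_mul_of_nonneg_left (hM _ (hn j)) hw
      _ = _ := by rw [← Finset.sum_mul, hW]; ring
  exact le_of_mul_le_mul_left this hdp

end KelloggAux

lemma hom_scale {m d : ℕ} {f : MvPolynomial (Fin m) ℝ} (hf : f.IsHomogeneous d) (u : ℂ)
    (w : Fin m → ℂ) : aeval (fun j => u * w j) f = u ^ d * aeval w f := by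
  rw [MvPolynomial.aeval_def, MvPolynomial.aeval_def, eval₂_eq, eval₂_eq, Finset.mul_sum]
  refine Finset.sum_congr rfl fun c hc => ?_
  have h := hf (mem_support_iff.mp hc)
  rw [Finsupp.weight_apply, Finsupp.sum] at h
  simp only [Pi.one_apply, smul_eq_mul, mul_one] at h
  simp_rw [mul_pow]
  rw [Finset.prod_mul_distrib, Finset.prod_pow_eq_pow_sum, h]
  ring

lemma chain {m : ℕ} (f : MvPolynomial (Fin m) ℝ) (L : Fin m → Polynomial ℂ) :
    Polynomial.derivative (aeval L f) =
      ∑ j, aeval L (pderiv j f) * Polynomial.derivative (L j) := by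
  induction f using MvPolynomial.induction_on with
  | C a => 
    simp [IsScalarTower.algebraMap_apply ℝ ℂ (Polynomial ℂ)]
  | add p q hp hq => simp [hp, hq, add_mul, Finset.sum_add_distrib]
  | mul_X p i hp =>
    have e : ∀ j, aeval L (pderiv j (p * X i)) * Polynomial.derivative (L j) =
        aeval L (pderiv j p) * Polynomial.derivative (L j) * L i +
        aeval L p * (if i = j then Polynomial.derivative (L j) else 0) := by
      intro j
      rw [pderiv_mul, map_add, map_mul, map_mul, aeval_X, pderiv_X]
      by_cases h : i = j
      · subst h; rw [if_pos rfl, Pi.single_eq_same, map_one]; ring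
      · rw [if_neg h, Pi.single_eq_of_ne h, map_zero]; ring
    simp_rw [e]
    rw [Finset.sum_add_distrib, ← Finset.sum_mul, ← Finset.mul_sum, ← hp, Finset.sum_ite_eq,
      if_pos (Finset.mem_univ i), map_mul, aeval_X, Polynomial.derivative_mul]

lemma aeval_real {m : ℕ} (f : MvPolynomial (Fin m) ℝ) (p : Fin m → ℝ) :
    aeval (fun j => (p j : ℂ)) f = ((eval p f : ℝ) : ℂ) := by
  have := MvPolynomial.aeval_algebraMap_apply (A := ℝ) ℂ p f
  simpa [MvPolynomial.aeval_eq_eval, Function.comp_def] using this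

lemma eval_aeval {m : ℕ} (f : MvPolynomial (Fin m) ℝ) (L : Fin m → Polynomial ℂ) (z : ℂ) :
    (aeval L f).eval z = aeval (fun j => (L j).eval z) f := by
  have := MvPolynomial.comp_aeval_apply (R := ℝ) (L) ((Polynomial.aeval (R := ℂ) z).restrictScalars ℝ) f
  simpa [Polynomial.aeval_def, Polynomial.eval₂_eq_eval_map] using this

lemma euler {m d : ℕ} {f : MvPolynomial (Fin m) ℝ} (hf : f.IsHomogeneous d) (x : Fin m → ℝ) :
    ∑ j, x j * eval x (pderiv j f) = d * eval x f := by
  have := congrArg (eval x) hf.sum_X_mul_pderiv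
  simpa [map_sum] using this

lemma planar {m d : ℕ} (hd : 1 ≤ d) {f : MvPolynomial (Fin m) ℝ} (hf : f.IsHomogeneous d)
    (M : ℝ) (hM : ∀ p : Fin m → ℝ, ∑ j, p j ^ 2 = 1 → |eval p f| ≤ M)
    (x y : Fin m → ℝ) (hx : ∑ j, x j ^ 2 = 1) (hy : ∑ j, y j ^ 2 = 1) (hxy : ∑ j, x j * y j = 0)
    (a b : ℝ) (hab : a ^ 2 + b ^ 2 = 1) :
    |∑ j, (a * x j + b * y j) * eval x (pderiv j f)| ≤ d * M := by
  set A : Fin m → ℂ := fun j => (x j - Complex.I * y j) / 2 with hA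
  set B : Fin m → ℂ := fun j => (x j + Complex.I * y j) / 2 with hB
  set L : Fin m → Polynomial ℂ := fun j => Polynomial.C (A j) * Polynomial.X + Polynomial.C (B j) with hL
  have hAB : ∀ j, A j + B j = x j := fun j => by simp only [hA, hB]; ring
  have hdeg : (aeval L f : Polynomial ℂ).natDegree ≤ d := by
    have := MvPolynomial.aeval_natDegree_le (n := 1) (MvPolynomial.map (algebraMap ℝ ℂ) f)
      (hf.map (algebraMap ℝ ℂ)).totalDegree_le L
      (fun j => Polynomial.natDegree_linear_le)
    rwa [MvPolynomial.aeval_map_algebraMap, mul_one] at this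
  have hbd : ∀ z : ℂ, ‖z‖ = 1 → ‖(aeval L f : Polynomial ℂ).eval z‖ ≤ M := by
    intro z hz
    obtain ⟨u, hu⟩ := IsAlgClosed.exists_pow_nat_eq z (n := 2) (by omega)
    have hun : ‖u‖ = 1 := by
      have := congrArg norm hu
      rw [norm_pow, hz] at this
      exact (pow_eq_one_iff_of_nonneg (norm_nonneg _) two_ne_zero).mp this
    have hsq : u.re ^ 2 + u.im ^ 2 = 1 := by
      have := Complex.sq_norm u
      rw [hun, Complex.normSq_apply] at this
      nlinarith
    have hsqc : (u.re : ℂ) ^ 2 + (u.im : ℂ) ^ 2 = 1 := by exact_mod_cast hsq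
    have hpt : ∀ j, (L j).eval z = u * ((u.re * x j + u.im * y j : ℝ) : ℂ) := by
      intro j
      simp only [hL, hA, hB, Polynomial.eval_add, Polynomial.eval_mul, Polynomial.eval_C, Polynomial.eval_X]
      rw [← hu]
      push_cast
      have hI := Complex.I_sq
      rw [← Complex.re_add_im u]
      simp only [Complex.add_re, Complex.add_im, Complex.ofReal_re, Complex.ofReal_im, Complex.mul_re, Complex.mul_im, Complex.I_re, Complex.I_im, mul_zero, mul_one, zero_mul, sub_zero, add_zero, zero_add]
      generalize (u.re : ℂ) = p at *
      generalize (u.im : ℂ) = q at *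
      generalize (x j : ℂ) = s at *
      generalize (y j : ℂ) = t at *
      have hI3 : Complex.I ^ 3 = - Complex.I := by rw [pow_succ, hI]; ring
      ring_nf
      simp only [hI, hI3]
      linear_combination (-(s + Complex.I * t)/2) * hsqc
    rw [eval_aeval]
    simp_rw [hpt]
    rw [hom_scale hf, aeval_real, norm_mul, norm_pow, hun, one_pow, one_mul, Complex.norm_real]
    apply hM
    have : ∀ j, (u.re * x j + u.im * y j) ^ 2 = u.re^2 * x j ^ 2 + u.im ^ 2 * y j ^ 2 + 2 * u.re * u.im * (x j * y j) := fun j => by ring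
    simp_rw [this, Finset.sum_add_distrib, ← Finset.mul_sum, hx, hy, hxy]
    linarith
  set μ : ℂ := a + b * Complex.I with hμ
  have hμn : ‖μ‖ = 1 := by
    have h : ‖μ‖ ^ 2 = 1 := by
      rw [Complex.sq_norm, hμ, Complex.normSq_add_mul_I, hab]
    exact (pow_eq_one_iff_of_nonneg (norm_nonneg _) two_ne_zero).mp h
  have main := malik hd (aeval L f) hdeg M hbd (μ ^ 2) (by rw [norm_pow, hμn, one_pow])
  have hL1 : ∀ g : MvPolynomial (Fin m) ℝ, (aeval L g : Polynomial ℂ).eval 1 = ((eval x g : ℝ) : ℂ) := by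
    intro g
    rw [eval_aeval, ← aeval_real]
    congr 2
    funext j
    simp [hL, hAB]
  have habc : (a : ℂ) ^ 2 + (b : ℂ) ^ 2 = 1 := by exact_mod_cast hab
  have hid : (d : ℂ) * (aeval L f : Polynomial ℂ).eval 1 + (μ ^ 2 - 1) * (Polynomial.derivative (aeval L f : Polynomial ℂ)).eval 1
      = μ * ((∑ j, (a * x j + b * y j) * eval x (pderiv j f) : ℝ) : ℂ) := by
    have hE : (d : ℂ) * ((eval x f : ℝ) : ℂ) = ((∑ j, x j * eval x (pderiv j f) : ℝ) : ℂ) := by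
      rw [euler hf]; push_cast; rfl
    rw [chain, Polynomial.eval_finsetSum, hL1, hE]
    push_cast
    rw [Finset.mul_sum, Finset.mul_sum, ← Finset.sum_add_distrib]
    refine Finset.sum_congr rfl fun j _ => ?_
    rw [Polynomial.eval_mul, hL1]
    have : (Polynomial.derivative (L j)).eval 1 = A j := by simp [hL]
    rw [this]
    simp only [hA, hμ]
    have hI := Complex.I_sq
    have hI3 : Complex.I ^ 3 = - Complex.I := by rw [pow_succ, hI]; ring
    generalize ((eval x (pderiv j f) : ℝ) : ℂ) = g
    generalize (x j : ℂ) = s at *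
    generalize (y j : ℂ) = t at *
    ring_nf
    simp only [hI, hI3]
    linear_combination (-(s * g) / 2 - Complex.I * t * g / 2) * habc
  rw [hid, norm_mul, hμn, one_mul, Complex.norm_real] at main
  exact main

lemma supNorm_bound {n q : ℕ} (f : Fin q → MvPolynomial (Fin (n + 1)) ℝ) (i : Fin q)
    (p : Fin (n + 1) → ℝ) (hp : ∑ j, p j ^ 2 = 1) : |eval p (f i)| ≤ polySupNorm f := by
  have hv : vnorm p = 1 := by rw [vnorm, hp, Real.sqrt_one]
  have hb : ∀ x : Fin (n + 1) → ℝ, vnorm x = 1 → ∀ k,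
      |eval x (f k)| ≤ ∑ c ∈ (f k).support, |coeff c (f k)| := by
    intro x hx k
    rw [eval_eq]
    refine (Finset.abs_sum_le_sum_abs _ _).trans (Finset.sum_le_sum fun c _ => ?_)
    rw [abs_mul, Finset.abs_prod]
    refine mul_le_of_le_one_right (abs_nonneg _) (Finset.prod_le_one (fun _ _ => abs_nonneg _) fun j _ => ?_)
    rw [abs_pow]
    refine pow_le_one₀ (abs_nonneg _) ?_
    have h1 : ∑ j, x j ^ 2 = 1 := by simpa [vnorm, Real.sqrt_eq_one] using hx
    have h2 : x j ^ 2 ≤ ∑ j, x j ^ 2 := Finset.single_le_sum (f := fun j => x j ^ 2) (fun _ _ => sq_nonneg _) (Finset.mem_univ j)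
    rw [h1] at h2
    exact (sq_le_one_iff_abs_le_one _).mp h2
  have : Nonempty (Fin q) := ⟨i⟩
  have h1 : |eval p (f i)| ≤ ⨆ k : Fin q, |eval p (f k)| :=
    le_ciSup (f := fun k => |eval p (f k)|) (Set.finite_range _).bddAbove i
  refine h1.trans ?_
  refine le_ciSup (f := fun x : {x : Fin (n + 1) → ℝ // vnorm x = 1} => ⨆ k : Fin q, |eval x.1 (f k)|) ?_ ⟨p, hv⟩
  refine ⟨∑ k, ∑ c ∈ (f k).support, |coeff c (f k)|, ?_⟩
  rintro _ ⟨x, rfl⟩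
  refine ciSup_le fun k => (hb x.1 x.2 k).trans ?_
  exact Finset.single_le_sum (f := fun k => ∑ c ∈ (f k).support, |coeff c (f k)|)
    (fun _ _ => Finset.sum_nonneg fun _ _ => abs_nonneg _) (Finset.mem_univ k)

theorem kellogg_real (n q : ℕ) (hn : 1 ≤ n) (hq : 1 ≤ q) (d : Fin q → ℕ)
    (hd : ∀ i, 1 ≤ d i) (f : Fin q → MvPolynomial (Fin (n + 1)) ℝ)
    (hf : ∀ i, (f i).IsHomogeneous (d i)) (v : Fin (n + 1) → ℝ)
    (x : Fin (n + 1) → ℝ) (hx : vnorm x = 1) (i : Fin q) :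
    (1 / (d i : ℝ)) * |∑ j, v j * eval x (pderiv j (f i))| ≤ polySupNorm f * vnorm v := by
  have hM := supNorm_bound f i
  set M := polySupNorm f
  have hx1 : ∑ j, x j ^ 2 = 1 := by simpa [vnorm, Real.sqrt_eq_one] using hx
  have hdp : (0 : ℝ) < d i := by exact_mod_cast hd i
  suffices h : |∑ j, v j * eval x (pderiv j (f i))| ≤ d i * M * vnorm v by
    rw [one_div, inv_mul_le_iff₀ hdp]; linarith
  set a := ∑ j, v j * x j with ha
  set w : Fin (n + 1) → ℝ := fun j => v j - a * x j with hw
  have hvw : ∀ j, v j = a * x j + w j := fun j => by simp [hw]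
  have hxw : ∑ j, x j * w j = 0 := by
    have : ∀ j, x j * w j = v j * x j - a * x j ^ 2 := fun j => by simp only [hw]; ring
    simp_rw [this, Finset.sum_sub_distrib, ← Finset.mul_sum, hx1]
    rw [← ha]; ring
  have hv2 : ∑ j, v j ^ 2 = a ^ 2 + ∑ j, w j ^ 2 := by
    have : ∀ j, v j ^ 2 = a ^ 2 * x j ^ 2 + 2 * a * (x j * w j) + w j ^ 2 := fun j => by
      rw [hvw j]; ring
    simp_rw [this, Finset.sum_add_distrib, ← Finset.mul_sum, hx1, hxw]; ring
  have hw0 : 0 ≤ ∑ j, w j ^ 2 := Finset.sum_nonneg fun _ _ => sq_nonneg _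
  rcases hw0.eq_or_lt with h0 | h0
  · have hwz : ∀ j, w j = 0 := by
      intro j
      have := (Finset.sum_eq_zero_iff_of_nonneg (fun j _ => sq_nonneg (w j))).mp h0.symm j (Finset.mem_univ j)
      exact pow_eq_zero_iff two_ne_zero |>.mp this
    have hvn : vnorm v = |a| := by rw [vnorm, hv2, ← h0, add_zero, Real.sqrt_sq_eq_abs]
    rw [hvn]
    simp_rw [hvw, hwz, add_zero, mul_assoc]
    rw [← Finset.mul_sum, euler (hf i), abs_mul, abs_mul, abs_of_pos hdp]
    have := mul_le_mul_of_nonneg_left (hM x hx1) (mul_nonneg hdp.le (abs_nonneg a))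
    linarith
  · set b := Real.sqrt (∑ j, w j ^ 2) with hb
    have hbp : 0 < b := Real.sqrt_pos.mpr h0
    have hb2 : b ^ 2 = ∑ j, w j ^ 2 := Real.sq_sqrt hw0
    set r := vnorm v with hr
    have hr2 : r ^ 2 = a ^ 2 + b ^ 2 := by
      rw [hr, vnorm, Real.sq_sqrt (Finset.sum_nonneg fun _ _ => sq_nonneg _), hv2, hb2]
    have hrp : 0 < r := by
      refine lt_of_le_of_ne (Real.sqrt_nonneg _) fun h => ?_
      rw [← h] at hr2; nlinarith [sq_nonneg a]
    have key := planar (hd i) (hf i) M hM x (fun j => w j / b) hx1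
      (by simp_rw [div_pow]; rw [← Finset.sum_div, ← hb2]; field_simp)
      (by simp_rw [← mul_div_assoc]; rw [← Finset.sum_div, hxw, zero_div])
      (a / r) (b / r) (by rw [div_pow, div_pow, ← add_div, ← hr2]; field_simp)
    have e : ∑ j, v j * eval x (pderiv j (f i)) =
        r * ∑ j, (a / r * x j + b / r * (w j / b)) * eval x (pderiv j (f i)) := by
      rw [Finset.mul_sum]
      refine Finset.sum_congr rfl fun j _ => ?_
      rw [hvw j]; field_simp
    rw [e, abs_mul, abs_of_pos hrp]
    have := mul_le_mul_of_nonneg_left key hrp.le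
    linarith
end

section
/- Let f = (f₁,…,f_q) be a tuple of real homogeneous polynomials in n+1 variables with deg fᵢ = dᵢ, and let x ∈ S^n. Then both max_i |fᵢ(x)| ≤ ‖f‖∞ and, for every nonzero v ∈ ℝ^{n+1} with ⟨v,x⟩ = 0 and every index i, (1/dᵢ)·|D̄ₓfᵢ(v)| ≤ ‖f‖∞·‖v‖₂; that is, max{ ‖f(x)‖∞ , ‖Δ⁻¹Dₓf‖_{2,∞} } ≤ ‖f‖∞, where Dₓf is the restriction of the derivative to the tangent space TₓS^n = x^⊥ and ‖A‖_{2,∞} := sup_{v≠0} ‖Av‖∞/‖v‖₂. -/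
open MvPolynomial

noncomputable def kAB : ℕ → Polynomial ℝ × Polynomial ℝ
  | 0 => (1, 0)
  | (k+1) => (Polynomial.X * (kAB k).1 - (kAB k).2, Polynomial.X * (kAB k).2 + (kAB k).1)

noncomputable def kA (k : ℕ) : Polynomial ℝ := (kAB k).1
noncomputable def kB (k : ℕ) : Polynomial ℝ := (kAB k).2

lemma kA_zero : kA 0 = 1 := rfl
lemma kB_zero : kB 0 = 0 := rfl
lemma kA_succ (k : ℕ) : kA (k+1) = Polynomial.X * kA k - kB k := rfl
lemma kB_succ (k : ℕ) : kB (k+1) = Polynomial.X * kB k + kA k := rfl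

lemma kAB_trig (φ : ℝ) (h : Real.sin φ ≠ 0) (k : ℕ) :
    Real.sin φ ^ k * (kA k).eval (Real.cos φ / Real.sin φ) = Real.cos (k * φ) ∧
    Real.sin φ ^ k * (kB k).eval (Real.cos φ / Real.sin φ) = Real.sin (k * φ) := by
  induction k with
  | zero => simp [kA_zero, kB_zero]
  | succ k ih =>
    obtain ⟨h1, h2⟩ := ih
    have e : ((k + 1 : ℕ) : ℝ) * φ = k * φ + φ := by push_cast; ring
    rw [e, Real.cos_add, Real.sin_add, ← h1, ← h2, kA_succ, kB_succ]
    simp only [Polynomial.eval_add, Polynomial.eval_sub, Polynomial.eval_mul, Polynomial.eval_X]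
    constructor
    · field_simp; ring
    · field_simp; ring

lemma kAB_sq (u : ℝ) (k : ℕ) : (kA k).eval u ^ 2 + (kB k).eval u ^ 2 = (u ^ 2 + 1) ^ k := by
  induction k with
  | zero => simp [kA_zero, kB_zero]
  | succ k ih =>
    rw [kA_succ, kB_succ, pow_succ (u ^ 2 + 1), ← ih]
    simp only [Polynomial.eval_add, Polynomial.eval_sub, Polynomial.eval_mul, Polynomial.eval_X]
    ring

lemma kAB_coeff (k : ℕ) :
    (∀ j, k < j → (kA k).coeff j = 0) ∧ (∀ j, k ≤ j → (kB k).coeff j = 0) ∧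
    (kA k).coeff k = 1 ∧ (∀ j, j + 1 = k → (kA k).coeff j = 0 ∧ (kB k).coeff j = k) := by
  induction k with
  | zero =>
    simp only [kA_zero, kB_zero]
    refine ⟨fun j hj => ?_, by simp, by simp, by simp⟩
    rw [Polynomial.coeff_one, if_neg (by omega)]
  | succ k ih =>
    obtain ⟨h1, h2, h3, h4⟩ := ih
    refine ⟨fun j hj => ?_, fun j hj => ?_, ?_, fun j hj => ?_⟩
    · obtain ⟨j, rfl⟩ : ∃ i, j = i + 1 := ⟨j - 1, by omega⟩
      rw [kA_succ, Polynomial.coeff_sub, Polynomial.coeff_X_mul, h1 _ (by omega), h2 _ (by omega)]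
      simp
    · obtain ⟨j, rfl⟩ : ∃ i, j = i + 1 := ⟨j - 1, by omega⟩
      rw [kB_succ, Polynomial.coeff_add, Polynomial.coeff_X_mul, h1 _ (by omega), h2 _ (by omega)]
      simp
    · rw [kA_succ, Polynomial.coeff_sub, Polynomial.coeff_X_mul, h3, h2 _ (by omega)]
      simp
    · obtain rfl : j = k := by omega
      rw [kA_succ, kB_succ, Polynomial.coeff_add, Polynomial.coeff_sub, h3, h2 _ le_rfl]
      cases j with
      | zero => simp
      | succ i =>
        rw [Polynomial.coeff_X_mul, Polynomial.coeff_X_mul, (h4 i rfl).1, (h4 i rfl).2]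
        simp

lemma kAB_deriv (k : ℕ) :
    Polynomial.derivative (kA (k+1)) = Polynomial.C ((k:ℝ)+1) * kA k ∧
    Polynomial.derivative (kB (k+1)) = Polynomial.C ((k:ℝ)+1) * kB k := by
  induction k with
  | zero => simp [kA_succ, kB_succ, kA_zero, kB_zero]
  | succ k ih =>
    obtain ⟨h1, h2⟩ := ih
    constructor
    · rw [kA_succ (k+1), Polynomial.derivative_sub, Polynomial.derivative_mul, h1, h2, kA_succ k]
      simp; ring
    · rw [kB_succ (k+1), Polynomial.derivative_add, Polynomial.derivative_mul, h1, h2, kB_succ k]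
      simp; ring

lemma kA_natDegree (k : ℕ) : (kA k).natDegree ≤ k :=
  Polynomial.natDegree_le_iff_coeff_eq_zero.2 (kAB_coeff k).1

lemma kA_monic (k : ℕ) : (kA k).Monic :=
  Polynomial.monic_of_natDegree_le_of_coeff_eq_one k (kA_natDegree k) (kAB_coeff k).2.2.1

noncomputable def kphi (m : ℕ) (i : Fin (m+1)) : ℝ := (2 * (i : ℕ) + 1) * Real.pi / (2 * (m + 1))

noncomputable def knode (m : ℕ) (i : Fin (m+1)) : ℝ :=
  Real.cos (kphi m i) / Real.sin (kphi m i)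

lemma kphi_mem (m : ℕ) (i : Fin (m+1)) : 0 < kphi m i ∧ kphi m i < Real.pi := by
  have hi : ((i : ℕ) : ℝ) + 1 ≤ m + 1 := by exact_mod_cast i.2
  unfold kphi
  constructor
  · positivity
  · rw [div_lt_iff₀ (by positivity)]
    nlinarith [Real.pi_pos]

lemma knode_inj (m : ℕ) : Function.Injective (knode m) := by
  have key : ∀ i, knode m i = Real.tan (Real.pi / 2 - kphi m i) := by
    intro i
    rw [Real.tan_pi_div_two_sub, Real.tan_eq_sin_div_cos, inv_div, knode]
  intro i j h
  rw [key, key] at h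
  have hi := kphi_mem m i
  have hj := kphi_mem m j
  have := Real.tan_inj_of_lt_of_lt_pi_div_two (by linarith) (by linarith) (by linarith)
    (by linarith) h
  have h2 : kphi m i = kphi m j := by linarith
  unfold kphi at h2
  have hp := Real.pi_pos
  have hm : (0:ℝ) < 2 * (m + 1) := by positivity
  rw [div_left_inj' hm.ne', mul_left_inj' hp.ne'] at h2
  have h3 : ((i : ℕ) : ℝ) = (j : ℕ) := by linarith
  exact Fin.ext (by exact_mod_cast h3)

lemma knode_root (m : ℕ) (i : Fin (m+1)) : (kA (m+1)).eval (knode m i) = 0 := by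
  have hs : Real.sin (kphi m i) ≠ 0 :=
    (Real.sin_pos_of_pos_of_lt_pi (kphi_mem m i).1 (kphi_mem m i).2).ne'
  have h := (kAB_trig _ hs (m+1)).1
  have h0 : Real.cos (((m+1 : ℕ) : ℝ) * kphi m i) = 0 := by
    rw [Real.cos_eq_zero_iff]
    refine ⟨(i : ℕ), ?_⟩
    unfold kphi
    push_cast
    field_simp
  rw [h0] at h
  exact (mul_eq_zero.1 h).resolve_left (pow_ne_zero _ hs)

lemma kA_eq_nodal (m : ℕ) : kA (m+1) = Lagrange.nodal Finset.univ (knode m) := by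
  apply Polynomial.eq_of_monic_of_dvd_of_natDegree_le (Lagrange.nodal_monic) (kA_monic _)
  · rw [Lagrange.nodal_eq]
    apply Finset.prod_dvd_of_coprime
    · intro i _ j _ hij
      exact Polynomial.isCoprime_X_sub_C_of_isUnit_sub
        (sub_ne_zero.2 (fun h => hij (knode_inj m h))).isUnit
    · intro i _
      exact Polynomial.dvd_iff_isRoot.2 (knode_root m i)
  · rw [Lagrange.natDegree_nodal]
    simpa using kA_natDegree (m+1)

lemma kbernstein (m : ℕ) (g : Polynomial ℝ) (hg : g.natDegree ≤ m + 1) (M : ℝ) (hM : 0 ≤ M)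
    (hb : ∀ u : ℝ, (g.eval u) ^ 2 ≤ M ^ 2 * (u ^ 2 + 1) ^ (m+1)) :
    |g.coeff m| ≤ M * (m + 1) := by
  classical
  have hinj : Set.InjOn (knode m) (Finset.univ : Finset (Fin (m+1))) := (knode_inj m).injOn
  obtain ⟨a1, a2, a3, a4⟩ := kAB_coeff (m+1)
  set W : Fin (m+1) → ℝ := fun i => ∏ j ∈ Finset.univ.erase i, (knode m i - knode m j) with hW
  have hWv : ∀ i, W i = (m+1) * (kA m).eval (knode m i) := by
    intro i
    have h := Lagrange.eval_nodal_derivative_eval_node_eq (v := knode m) (Finset.mem_univ i)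
    rw [Lagrange.eval_nodal, ← kA_eq_nodal, (kAB_deriv m).1] at h
    rw [hW]
    simp only
    rw [← h]
    simp
  have hBv : ∀ i, (kB (m+1)).eval (knode m i) = (knode m i ^ 2 + 1) * (kA m).eval (knode m i) := by
    intro i
    have h := knode_root m i
    rw [kA_succ] at h
    rw [kB_succ]
    simp only [Polynomial.eval_add, Polynomial.eval_sub, Polynomial.eval_mul,
      Polynomial.eval_X] at h ⊢
    linear_combination (-knode m i) * h
  have lag : ∀ P : Polynomial ℝ, (∀ j, m + 1 ≤ j → P.coeff j = 0) →
      P.coeff m = ∑ i, P.eval (knode m i) / W i := by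
    intro P hP
    have hdeg : P.degree < (Finset.univ : Finset (Fin (m+1))).card := by
      rw [Polynomial.degree_lt_iff_coeff_zero]
      intro j hj
      exact hP j (by simpa using hj)
    simpa using Lagrange.coeff_eq_sum hinj hdeg
  have e1 : g.coeff m = ∑ i, g.eval (knode m i) / W i := by
    have h := lag (g - Polynomial.C (g.coeff (m+1)) * kA (m+1)) (by
      intro j hj
      rw [Polynomial.coeff_sub, Polynomial.coeff_C_mul]
      rcases hj.eq_or_lt with rfl | hj
      · rw [a3]; ring
      · rw [a1 j hj, Polynomial.coeff_eq_zero_of_natDegree_lt (by omega)]; ring)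
    simpa [(a4 m rfl).1, knode_root] using h
  have e2 : ((m:ℝ)+1) = ∑ i, (kB (m+1)).eval (knode m i) / W i := by
    rw [← lag _ a2, (a4 m rfl).2]; push_cast; rfl
  rw [e1, e2, Finset.mul_sum]
  refine (Finset.abs_sum_le_sum_abs _ _).trans (Finset.sum_le_sum fun i _ => ?_)
  have hpos : 0 ≤ (kB (m+1)).eval (knode m i) / W i := by
    rw [hWv, hBv]
    rw [show ∀ a b c : ℝ, (a * b) / (c * b) = (a / c) * (b / b) by intros; ring]
    have : 0 ≤ (kA m).eval (knode m i) / (kA m).eval (knode m i) := by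
      rcases eq_or_ne ((kA m).eval (knode m i)) 0 with h | h
      · simp [h]
      · simp [h]
    positivity
  rw [← abs_of_nonneg hpos, abs_div, abs_div, ← mul_div_assoc]
  apply div_le_div_of_nonneg_right _ (abs_nonneg _)
  rw [← abs_of_nonneg hM, ← abs_mul]
  apply sq_le_sq.1
  have h := kAB_sq (knode m i) (m+1)
  rw [knode_root] at h
  rw [mul_pow]
  have h' : (kB (m+1)).eval (knode m i) ^ 2 = (knode m i ^ 2 + 1) ^ (m+1) := by linarith
  rw [h']
  exact hb _

lemma keval_smul {n d : ℕ} (f : MvPolynomial (Fin n) ℝ) (hf : f.IsHomogeneous d) (c : ℝ)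
    (x : Fin n → ℝ) : eval (fun j => c * x j) f = c ^ d * eval x f := by
  rw [eval_eq, eval_eq, Finset.mul_sum]
  refine Finset.sum_congr rfl fun e he => ?_
  have h : ∑ i ∈ e.support, e i = d := by
    have := hf (mem_support_iff.1 he)
    simpa [Finsupp.weight_apply, Finsupp.sum] using this
  simp_rw [mul_pow]
  rw [Finset.prod_mul_distrib, Finset.prod_pow_eq_pow_sum, h]
  ring

lemma kderiv {n : ℕ} (f : MvPolynomial (Fin n) ℝ) (p : Fin n → Polynomial ℝ) :
    Polynomial.derivative (aeval p f) =
      ∑ j, Polynomial.derivative (p j) * aeval p (pderiv j f) := by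
  classical
  induction f using MvPolynomial.induction_on with
  | C a => simp
  | add f g hf hg => simp [hf, hg, mul_add, Finset.sum_add_distrib]
  | mul_X f i hf =>
    simp only [map_mul, aeval_X, Polynomial.derivative_mul, hf, Derivation.leibniz, pderiv_X,
      smul_eq_mul, map_add, mul_add, Finset.sum_add_distrib, Finset.sum_mul]
    rw [add_comm]
    congr 1
    · rw [Finset.sum_eq_single i]
      · simp; ring
      · intro j _ hj
        simp [Pi.single_apply, hj.symm]
      · simp
    · refine Finset.sum_congr rfl fun j _ => ?_
      ring

lemma keval_aeval {n : ℕ} (f : MvPolynomial (Fin n) ℝ) (p : Fin n → Polynomial ℝ) (t : ℝ) :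
    (aeval p f).eval t = eval (fun j => (p j).eval t) f := by
  induction f using MvPolynomial.induction_on with
  | C a => simp
  | add f g hf hg => simp [hf, hg]
  | mul_X f i hf => simp [hf]

lemma kpoly {n m : ℕ} (f : MvPolynomial (Fin n) ℝ) (hf : f.IsHomogeneous (m+1))
    (x y : Fin n → ℝ) : ∃ g : Polynomial ℝ, g.natDegree ≤ m + 1 ∧
      g.coeff m = ∑ j, y j * eval x (pderiv j f) ∧
      ∀ u, g.eval u = eval (fun j => u * x j + y j) f := by
  set p : Fin n → Polynomial ℝ := fun j => Polynomial.C (y j) * Polynomial.X + Polynomial.C (x j)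
    with hp
  set h : Polynomial ℝ := aeval p f with hh
  set g1 : Polynomial ℝ :=
    aeval (fun j => Polynomial.C (x j) * Polynomial.X + Polynomial.C (y j)) f with hg1
  have hdeg : h.natDegree ≤ m + 1 :=
    (MvPolynomial.aeval_natDegree_le f hf.totalDegree_le _
      (fun _ => Polynomial.natDegree_linear_le)).trans (by omega)
  have hc1 : h.coeff 1 = ∑ j, y j * eval x (pderiv j f) := by
    have e : h.coeff 1 = (Polynomial.derivative h).eval 0 := by
      rw [← Polynomial.coeff_zero_eq_eval_zero, Polynomial.coeff_derivative]; simp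
    rw [e, hh, kderiv, Polynomial.eval_finset_sum]
    refine Finset.sum_congr rfl fun j _ => ?_
    rw [Polynomial.eval_mul, keval_aeval]
    simp [hp]
  have heq : h.reflect (m+1) = g1 := by
    apply Polynomial.eq_of_infinite_eval_eq
    refine Set.Infinite.mono ?_ (Set.Ioi_infinite (0:ℝ))
    intro u hu
    have hu0 : u ≠ 0 := ne_of_gt hu
    letI : Invertible u⁻¹ := invertibleOfNonzero (inv_ne_zero hu0)
    have key := Polynomial.eval₂_reflect_mul_pow (RingHom.id ℝ) u⁻¹ (m+1) h hdeg
    rw [invOf_eq_inv, inv_inv] at key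
    change Polynomial.eval u _ * _ = Polynomial.eval _ h at key
    rw [hh, keval_aeval] at key
    change Polynomial.eval u _ = Polynomial.eval u g1
    rw [hg1, keval_aeval]
    have e : (fun j => Polynomial.eval u (Polynomial.C (x j) * Polynomial.X + Polynomial.C (y j)))
        = fun j => u * Polynomial.eval u⁻¹ (p j) := by
      funext j; simp [hp]; field_simp; ring
    rw [e, keval_smul f hf, ← key, ← hh, inv_pow]
    field_simp
  refine ⟨g1, ?_, ?_, ?_⟩
  · exact (MvPolynomial.aeval_natDegree_le f hf.totalDegree_le _
      (fun _ => Polynomial.natDegree_linear_le)).trans (by omega)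
  · rw [← heq, Polynomial.coeff_reflect, Polynomial.revAt_le (by omega), ← hc1]
    congr 1; omega
  · intro u
    rw [hg1, keval_aeval]
    congr 2
    funext j; simp; ring

lemma kvnorm_sq {m : ℕ} (v : Fin m → ℝ) : vnorm v ^ 2 = ∑ j, v j ^ 2 :=
  Real.sq_sqrt (Finset.sum_nonneg fun j _ => sq_nonneg _)

lemma kcompact (m : ℕ) : IsCompact {x : Fin m → ℝ | vnorm x = 1} := by
  refine IsCompact.of_isClosed_subset (isCompact_Icc (a := fun _ => (-1:ℝ)) (b := fun _ => 1)) ?_ ?_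
  · apply isClosed_eq _ continuous_const
    unfold vnorm
    fun_prop
  · intro x hx
    have hs : ∑ j, x j ^ 2 = 1 := by
      rw [← kvnorm_sq, show vnorm x = 1 from hx]; norm_num
    have : ∀ j, |x j| ≤ 1 := by
      intro j
      rw [← sq_le_one_iff_abs_le_one, ← hs]
      exact Finset.single_le_sum (f := fun j => x j ^ 2) (fun j _ => sq_nonneg _)
        (Finset.mem_univ j)
    exact ⟨fun j => (abs_le.1 (this j)).1, fun j => (abs_le.1 (this j)).2⟩

lemma kle_norm {n q : ℕ} (f : Fin q → MvPolynomial (Fin (n + 1)) ℝ) (x : Fin (n + 1) → ℝ)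
    (hx : vnorm x = 1) (i : Fin q) : |eval x (f i)| ≤ polySupNorm f := by
  have hb : ∀ i, ∃ B, ∀ x : Fin (n+1) → ℝ, vnorm x = 1 → |eval x (f i)| ≤ B := by
    intro i
    obtain ⟨B, hB⟩ := (kcompact (n+1)).exists_bound_of_continuousOn
      (f := fun x => eval x (f i)) (MvPolynomial.continuous_eval _).continuousOn
    exact ⟨B, fun x hx => hB x hx⟩
  choose B hB using hb
  have : Nonempty (Fin q) := ⟨i⟩
  have hbdd : BddAbove (Set.range fun x : {x : Fin (n + 1) → ℝ // vnorm x = 1} =>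
      ⨆ i : Fin q, |eval x.1 (f i)|) := by
    refine ⟨∑ i, |B i|, ?_⟩
    rintro _ ⟨x, rfl⟩
    refine ciSup_le fun i => ?_
    refine ((hB i x.1 x.2).trans (le_abs_self _)).trans ?_
    exact Finset.single_le_sum (f := fun i => |B i|) (fun j _ => abs_nonneg _) (Finset.mem_univ i)
  refine le_trans ?_ (le_ciSup hbdd ⟨x, hx⟩)
  exact le_ciSup (f := fun i => |eval x (f i)|) (Set.finite_range _).bddAbove i

lemma kle_norm_hom {n q d : ℕ} (f : Fin q → MvPolynomial (Fin (n + 1)) ℝ) (i : Fin q)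
    (hf : (f i).IsHomogeneous d) (z : Fin (n + 1) → ℝ) (hz : 0 < vnorm z) :
    |eval z (f i)| ≤ polySupNorm f * vnorm z ^ d := by
  have h1 : vnorm (fun j => (vnorm z)⁻¹ * z j) = 1 := by
    have : vnorm (fun j => (vnorm z)⁻¹ * z j) ^ 2 = 1 := by
      rw [kvnorm_sq]
      simp_rw [mul_pow]
      rw [← Finset.mul_sum, ← kvnorm_sq]
      field_simp
    have h0 : 0 ≤ vnorm (fun j => (vnorm z)⁻¹ * z j) := Real.sqrt_nonneg _
    nlinarith
  have h2 := kle_norm f _ h1 i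
  rw [keval_smul _ hf, abs_mul, abs_of_nonneg (by positivity), inv_pow] at h2
  rwa [inv_mul_le_iff₀ (by positivity), mul_comm] at h2

/-- Corollary 2.14, real case: both the value of `f` at `x ∈ Sⁿ` and the `(2,∞)`-operator
norm of `Δ⁻¹ Dₓf` (the derivative restricted to the tangent space `TₓSⁿ = x^⊥`) are bounded
by the real `L∞`-norm of `f`. -/
theorem kellogg_corollary_real (n q : ℕ) (hn : 1 ≤ n) (hq : 1 ≤ q) (d : Fin q → ℕ)
    (hd : ∀ i, 1 ≤ d i) (f : Fin q → MvPolynomial (Fin (n + 1)) ℝ)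
    (hf : ∀ i, (f i).IsHomogeneous (d i))
    (x : Fin (n + 1) → ℝ) (hx : vnorm x = 1) :
    (∀ i, |eval x (f i)| ≤ polySupNorm f) ∧
    (∀ v : Fin (n + 1) → ℝ, v ≠ 0 → (∑ j, v j * x j) = 0 → ∀ i,
      (1 / (d i : ℝ)) * |∑ j, v j * eval x (pderiv j (f i))| ≤ polySupNorm f * vnorm v) := by
  refine ⟨kle_norm f x hx, fun v hv hvx i => ?_⟩
  have hM : 0 ≤ polySupNorm f := (abs_nonneg _).trans (kle_norm f x hx i)
  have hv2 : 0 < ∑ j, v j ^ 2 := by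
    obtain ⟨j, hj⟩ := Function.ne_iff.1 hv
    exact Finset.sum_pos' (fun j _ => sq_nonneg _) ⟨j, Finset.mem_univ j, by
      have : v j ≠ 0 := hj
      positivity⟩
  have hvn : 0 < vnorm v := Real.sqrt_pos.2 hv2
  obtain ⟨m, hm⟩ : ∃ m, d i = m + 1 := ⟨d i - 1, by have := hd i; omega⟩
  have hfi := hf i
  rw [hm] at hfi ⊢
  obtain ⟨g, g1, g2, g3⟩ := kpoly (f i) hfi x (fun j => (vnorm v)⁻¹ * v j)
  have hx2 : ∑ j, x j ^ 2 = 1 := by rw [← kvnorm_sq, hx]; norm_num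
  have hz : ∀ u : ℝ, vnorm (fun j => u * x j + (vnorm v)⁻¹ * v j) ^ 2 = u ^ 2 + 1 := by
    intro u
    rw [kvnorm_sq]
    have e : ∀ j, (u * x j + (vnorm v)⁻¹ * v j) ^ 2 =
      u ^ 2 * x j ^ 2 + 2 * u * (vnorm v)⁻¹ * (v j * x j) + ((vnorm v)⁻¹) ^ 2 * v j ^ 2 := by
      intro j; ring
    simp_rw [e]
    rw [Finset.sum_add_distrib, Finset.sum_add_distrib, ← Finset.mul_sum, ← Finset.mul_sum,
      ← Finset.mul_sum, hx2, hvx, ← kvnorm_sq v]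
    field_simp
    ring
  have key := kbernstein m g g1 (polySupNorm f) hM (by
    intro u
    have hpos : 0 < vnorm (fun j => u * x j + (vnorm v)⁻¹ * v j) := by
      have h0 : 0 ≤ vnorm (fun j => u * x j + (vnorm v)⁻¹ * v j) := Real.sqrt_nonneg _
      have h1 := hz u
      rcases h0.eq_or_lt with h | h
      · rw [← h] at h1; nlinarith [sq_nonneg u]
      · exact h
    have := kle_norm_hom f i hfi _ hpos
    rw [g3, ← hz u, ← pow_mul, mul_comm 2, pow_mul, ← mul_pow, ← sq_abs]
    exact pow_le_pow_left₀ (abs_nonneg _) this 2)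
  rw [g2] at key
  simp_rw [mul_assoc] at key
  rw [← Finset.mul_sum, abs_mul, abs_of_pos (inv_pos.2 hvn), inv_mul_le_iff₀ hvn] at key
  push_cast
  rw [one_div, inv_mul_le_iff₀ (by positivity)]
  linarith
end

section
/- Let f = (f₁,…,f_q) be a tuple of real homogeneous polynomials in n+1 variables with deg fᵢ = dᵢ, and let μ be the uniform probability measure on S^n. Then for every real p with 2 ≤ p < ∞, ( ∫_{S^n} Σᵢ |fᵢ(x)|^p dμ(x) )^{1/p} ≤ ‖f‖_W, and moreover ‖f‖∞ ≤ ‖f‖_W. -/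
open MvPolynomial MeasureTheory

/-- Squared Weyl norm of a real polynomial. -/
noncomputable def weylNormSq {n : ℕ} (f : MvPolynomial (Fin (n + 1)) ℝ) : ℝ :=
  ∑ α ∈ f.support, ((Finsupp.multinomial α : ℝ))⁻¹ * (coeff α f) ^ 2

/-- Weyl norm of a tuple of real polynomials. -/
noncomputable def weylNorm {n q : ℕ} (f : Fin q → MvPolynomial (Fin (n + 1)) ℝ) : ℝ :=
  Real.sqrt (∑ i, weylNormSq (f i))

/-- Pointwise bound by Cauchy-Schwarz and the multinomial theorem. -/
theorem sq_eval_le {n : ℕ} (g : MvPolynomial (Fin (n + 1)) ℝ) (d : ℕ)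
    (hg : g.IsHomogeneous d) (x : Fin (n + 1) → ℝ) (hx : vnorm x = 1) :
    (eval x g) ^ 2 ≤ weylNormSq g := by
  have hx2 : ∑ j, x j ^ 2 = 1 := by
    unfold vnorm at hx
    exact Real.sqrt_eq_one.mp hx
  have hmpos : ∀ α : Fin (n + 1) →₀ ℕ, 0 < (Finsupp.multinomial α : ℝ) := by
    intro α
    have : 0 < Finsupp.multinomial α := by
      unfold Finsupp.multinomial
      exact Nat.multinomial_pos _ _
    exact_mod_cast this
  have hm : ∑ α ∈ g.support, (Finsupp.multinomial α : ℝ) * ∏ j, (x j ^ 2) ^ α j ≤ 1 := by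
    have h := Finset.sum_pow_eq_sum_piAntidiag (Finset.univ : Finset (Fin (n + 1)))
      (fun j => x j ^ 2) d
    rw [hx2, one_pow] at h
    rw [h]
    have himg : ∑ α ∈ g.support, (Finsupp.multinomial α : ℝ) * ∏ j, (x j ^ 2) ^ α j
        = ∑ k ∈ g.support.image (fun α : Fin (n + 1) →₀ ℕ => (α : Fin (n + 1) → ℕ)),
          (Nat.multinomial Finset.univ k : ℝ) * ∏ j, (x j ^ 2) ^ k j := by
      rw [Finset.sum_image (fun a _ b _ hab => DFunLike.coe_injective hab)]
      refine Finset.sum_congr rfl fun α _ => ?_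
      rw [Finsupp.multinomial_of_support_subset (Finset.subset_univ _)]
    rw [himg]
    refine Finset.sum_le_sum_of_subset_of_nonneg ?_ ?_
    · intro k hk
      obtain ⟨α, hα, rfl⟩ := Finset.mem_image.mp hk
      rw [Finset.mem_piAntidiag]
      refine ⟨?_, by simp⟩
      have := hg (MvPolynomial.mem_support_iff.mp hα)
      rw [← this, Finsupp.weight_apply, Finsupp.sum_fintype _ _ (by simp)]
      simp
    · intro k _ _
      positivity
  have hcs := Finset.sum_sq_le_sum_mul_sum_of_sq_le_mul g.support
    (r := fun α => coeff α g * ∏ j, x j ^ α j)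
    (f := fun α => ((Finsupp.multinomial α : ℝ))⁻¹ * (coeff α g) ^ 2)
    (g := fun α => (Finsupp.multinomial α : ℝ) * ∏ j, (x j ^ 2) ^ α j)
    (fun α _ => by have := hmpos α; positivity) (fun α _ => by positivity)
    (fun α _ => le_of_eq <| by
      have := (hmpos α).ne'
      have h2 : ∏ j, (x j ^ 2) ^ α j = (∏ j, x j ^ α j) ^ 2 := by
        rw [← Finset.prod_pow]
        exact Finset.prod_congr rfl fun j _ => by rw [← pow_mul, ← pow_mul, mul_comm]
      rw [h2]
      field_simp)
  rw [MvPolynomial.eval_eq']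
  refine hcs.trans ?_
  refine mul_le_of_le_one_right ?_ hm
  exact Finset.sum_nonneg fun α _ => by have := hmpos α; positivity

/-- Proposition 2.10, real case: for `2 ≤ p < ∞`, the `L_p`-norm of a real homogeneous
polynomial tuple over the sphere (with the uniform probability measure `μ`, characterized
as the orthogonally invariant probability measure concentrated on the sphere) is bounded
by the Weyl norm; and also `‖f‖∞ ≤ ‖f‖_W`. -/
theorem lp_norm_le_weyl (n q : ℕ) (hn : 1 ≤ n) (hq : 1 ≤ q) (d : Fin q → ℕ)
    (hd : ∀ i, 1 ≤ d i) (f : Fin q → MvPolynomial (Fin (n + 1)) ℝ)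
    (hf : ∀ i, (f i).IsHomogeneous (d i))
    (μ : Measure (Fin (n + 1) → ℝ)) [IsProbabilityMeasure μ]
    (hsupp : μ {x | vnorm x = 1} = 1)
    (hinv : ∀ U ∈ Matrix.orthogonalGroup (Fin (n + 1)) ℝ,
      Measure.map (fun x => Matrix.mulVec U x) μ = μ) :
    (∀ p : ℝ, 2 ≤ p →
      (∫ x, ∑ i, |eval x (f i)| ^ p ∂μ) ^ (1 / p) ≤ weylNorm f) ∧
    polySupNorm f ≤ weylNorm f := by
  have hsum : ∀ x : Fin (n + 1) → ℝ, vnorm x = 1 →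
      ∑ i, |eval x (f i)| ^ 2 ≤ weylNorm f ^ 2 := by
    intro x hx
    have h : ∑ i, |eval x (f i)| ^ 2 ≤ ∑ i, weylNormSq (f i) :=
      Finset.sum_le_sum fun i _ => by
        rw [sq_abs]
        exact sq_eval_le (f i) (d i) (hf i) x hx
    unfold weylNorm
    rwa [Real.sq_sqrt ((Finset.sum_nonneg fun i _ => by positivity).trans h)]
  have hN : 0 ≤ weylNorm f := Real.sqrt_nonneg _
  have hpt : ∀ x : Fin (n + 1) → ℝ, vnorm x = 1 → ∀ i, |eval x (f i)| ≤ weylNorm f := by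
    intro x hx i
    refine abs_le_of_sq_le_sq' ?_ hN |>.2
    exact (Finset.single_le_sum (f := fun i => |eval x (f i)| ^ 2)
      (fun i _ => by positivity) (Finset.mem_univ i)).trans (hsum x hx)
  refine ⟨?_, ?_⟩
  · intro p hp
    have hp0 : 0 < p := by linarith
    have hsplit : ∀ t : ℝ, 0 ≤ t → t ^ p = t ^ 2 * t ^ (p - 2) := by
      intro t ht
      have h := Real.rpow_add_of_nonneg ht (y := 2) (z := p - 2) (by norm_num) (by linarith)
      rw [add_sub_cancel] at h
      rw [h, Real.rpow_two]
    have hb : ∀ x : Fin (n + 1) → ℝ, vnorm x = 1 →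
        ∑ i, |eval x (f i)| ^ p ≤ weylNorm f ^ p := by
      intro x hx
      calc ∑ i, |eval x (f i)| ^ p
          ≤ ∑ i, |eval x (f i)| ^ 2 * weylNorm f ^ (p - 2) := by
            refine Finset.sum_le_sum fun i _ => ?_
            rw [hsplit _ (abs_nonneg _)]
            exact mul_le_mul_of_nonneg_left
              (Real.rpow_le_rpow (abs_nonneg _) (hpt x hx i) (by linarith)) (by positivity)
        _ = (∑ i, |eval x (f i)| ^ 2) * weylNorm f ^ (p - 2) := by rw [Finset.sum_mul]
        _ ≤ weylNorm f ^ 2 * weylNorm f ^ (p - 2) :=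
            mul_le_mul_of_nonneg_right (hsum x hx) (Real.rpow_nonneg hN _)
        _ = weylNorm f ^ p := (hsplit _ hN).symm
    have hmeas : MeasurableSet {x : Fin (n + 1) → ℝ | vnorm x = 1} := by
      have : Measurable (fun x : Fin (n + 1) → ℝ => vnorm x) := by
        unfold vnorm
        fun_prop
      exact this (measurableSet_singleton 1)
    have hae : ∀ᵐ x ∂μ, vnorm x = 1 := (prob_compl_eq_zero_iff hmeas).mpr hsupp
    have hnn : ∀ x : Fin (n + 1) → ℝ, 0 ≤ ∑ i, |eval x (f i)| ^ p := fun x =>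
      Finset.sum_nonneg fun i _ => Real.rpow_nonneg (abs_nonneg _) _
    have hint : ∫ x, ∑ i, |eval x (f i)| ^ p ∂μ ≤ weylNorm f ^ p := by
      have h := norm_integral_le_of_norm_le_const (μ := μ)
        (f := fun x => ∑ i, |eval x (f i)| ^ p) (C := weylNorm f ^ p) (by
          filter_upwards [hae] with x hx
          rw [Real.norm_of_nonneg (hnn x)]
          exact hb x hx)
      simp only [probReal_univ, mul_one] at h
      exact (Real.le_norm_self _).trans h
    calc (∫ x, ∑ i, |eval x (f i)| ^ p ∂μ) ^ (1 / p)
        ≤ (weylNorm f ^ p) ^ (1 / p) :=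
          Real.rpow_le_rpow (integral_nonneg hnn) hint (by positivity)
      _ = weylNorm f := by
          rw [← Real.rpow_mul hN, mul_one_div_cancel hp0.ne', Real.rpow_one]
  · unfold polySupNorm
    exact Real.iSup_le (fun x => Real.iSup_le (fun i => hpt x.1 x.2 i) hN) hN
end

section
/- Let f be a single real homogeneous polynomial of degree d ≥ 1 in the n+1 variables X₀,…,X_n. Then ‖f‖∞ ≤ ‖f‖_W ≤ (n+1)^{d/2} · ‖f‖∞, where ‖f‖∞ := max_{x∈S^n} |f(x)| and ‖f‖_W is the Weyl norm. -/
open MvPolynomial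

/-- The real `L∞`-norm of a single polynomial: max of `|f|` over the unit sphere. -/
noncomputable def polySupNorm1 {n : ℕ} (f : MvPolynomial (Fin (n + 1)) ℝ) : ℝ :=
  ⨆ x : {x : Fin (n + 1) → ℝ // vnorm x = 1}, |eval x.1 f|

theorem banach_symm_aux {ι E : Type*} [Fintype ι] [DecidableEq ι] [NormedAddCommGroup E]
    [InnerProductSpace ℝ E] [ProperSpace E] (T : MultilinearMap ℝ (fun _ : ι => E) ℝ)
    (p k : ι) (hpk : p ≠ k)
    (hsym : ∀ (x : ι → E) (u w : E), T (Function.update (Function.update x p u) k w) =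
      T (Function.update (Function.update x p w) k u))
    (K : ℝ) (z : ι → E) (hz : ∀ i, ‖z i‖ = 1)
    (hK : ∀ x : ι → E, (∀ i, ‖x i‖ = 1) → |T x| ≤ K) (hzK : |T z| = K)
    (hs : z p + z k ≠ 0) :
    |T (Function.update (Function.update z p (‖z p + z k‖⁻¹ • (z p + z k))) k
      (‖z p + z k‖⁻¹ • (z p + z k)))| = K := by
  set B : E → E → ℝ := fun v w => T (Function.update (Function.update z p v) k w) with hB
  have addr : ∀ v w w', B v (w + w') = B v w + B v w' := fun v w w' => T.map_update_add _ _ _ _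
  have smulr : ∀ v w (c : ℝ), B v (c • w) = c * B v w := fun v w c =>
    T.map_update_smul (Function.update z p v) k c w
  have symm : ∀ v w, B v w = B w v := fun v w => hsym z v w
  have addl : ∀ v w w', B (w + w') v = B w v + B w' v := fun v w w' => by
    rw [symm, addr, symm v, symm v]
  have smull : ∀ v w (c : ℝ), B (c • w) v = c * B w v := fun v w c => by
    rw [symm, smulr, symm]
  have unit : ∀ v w, ‖v‖ = 1 → ‖w‖ = 1 → |B v w| ≤ K := by
    intro v w hv hw
    apply hK
    intro i
    by_cases h1 : i = k
    · subst h1; simpa using hw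
    · by_cases h2 : i = p
      · subst h2; simpa [Function.update_of_ne h1] using hv
      · simp [Function.update_of_ne h1, Function.update_of_ne h2, hz]
  have quad : ∀ v, |B v v| ≤ K * ‖v‖ ^ 2 := by
    intro v
    by_cases hv : v = 0
    · subst hv
      have := smulr 0 0 0
      simp at this
      simp [this]
    · have hv' : 0 < ‖v‖ := norm_pos_iff.2 hv
      have h1 : ‖(‖v‖⁻¹ • v)‖ = 1 := by
        rw [norm_smul, norm_inv, norm_norm]; field_simp
      have h2 := unit _ _ h1 h1
      rw [smulr, smull, ← mul_assoc, abs_mul, abs_of_pos (by positivity)] at h2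
      have : |B v v| = ‖v‖ ^ 2 * (‖v‖⁻¹ * ‖v‖⁻¹ * |B v v|) := by field_simp
      rw [this, mul_comm K]
      gcongr
  set u := z p with hu
  set w := z k with hw
  have hBz : B u w = T z := by simp [hB, hu, hw]
  set s := u + w with hsdef
  have hs' : 0 < ‖s‖ := norm_pos_iff.2 hs
  have e1 : B s s - B (u - w) (u - w) = 4 * B u w := by
    have : u - w = u + (-1 : ℝ) • w := by simp [sub_eq_add_neg]
    rw [this, hsdef]
    simp only [addl, addr, smulr, smull]
    rw [symm w u]; ring
  have par := parallelogram_law_with_norm ℝ u w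
  rw [hz p, hz k] at par
  have q1 := quad s
  have q2 := quad (u - w)
  have e2 : |B s s| = K * ‖s‖ ^ 2 := by
    apply le_antisymm q1
    have : |4 * B u w| ≤ |B s s| + |B (u - w) (u - w)| := by rw [← e1]; exact abs_sub _ _
    rw [abs_mul, hBz, hzK, abs_of_pos (by norm_num : (0:ℝ) < 4)] at this
    have : K * ‖s‖ ^ 2 + K * ‖u - w‖ ^ 2 = 4 * K := by
      rw [hsdef]; linear_combination K * par
    linarith
  change |B (‖s‖⁻¹ • s) (‖s‖⁻¹ • s)| = K
  rw [smulr, smull, ← mul_assoc, abs_mul, abs_of_pos (by positivity), e2]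
  field_simp

theorem banach_symm {ι E : Type*} [Fintype ι] [DecidableEq ι] [NormedAddCommGroup E]
    [InnerProductSpace ℝ E] [ProperSpace E] (T : MultilinearMap ℝ (fun _ : ι => E) ℝ)
    (hc : Continuous T) (a : ι)
    (hsym : ∀ (p k : ι), p ≠ k → ∀ (x : ι → E) (u w : E),
      T (Function.update (Function.update x p u) k w) =
      T (Function.update (Function.update x p w) k u))
    (M : ℝ) (hM : ∀ y : E, ‖y‖ = 1 → |T (fun _ => y)| ≤ M)
    (x : ι → E) (hx : ∀ i, ‖x i‖ = 1) : |T x| ≤ M := by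
  have hcomp : IsCompact {x : ι → E | ∀ i, ‖x i‖ = 1} := by
    have := isCompact_univ_pi (fun _ : ι => isCompact_sphere (0 : E) 1)
    convert this using 1
    ext x; simp
  obtain ⟨x0, hx0, hmax⟩ := hcomp.exists_isMaxOn ⟨x, hx⟩ (f := fun x => |T x|) (by fun_prop)
  set K := |T x0| with hKdef
  have hK : ∀ x : ι → E, (∀ i, ‖x i‖ = 1) → |T x| ≤ K := fun x hx => hmax hx
  refine (hK x hx).trans ?_
  set e := x0 a with he
  set σ : ι → ℝ := fun i => if 0 ≤ inner ℝ (x0 i) e then 1 else -1 with hσ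
  have hσa : ∀ i, |σ i| = 1 := fun i => by simp only [hσ]; split_ifs <;> simp
  set x1 : ι → E := fun i => σ i • x0 i with hx1
  have hx1n : ∀ i, ‖x1 i‖ = 1 := fun i => by
    simp only [hx1, norm_smul, Real.norm_eq_abs, hσa, one_mul]; exact hx0 i
  have hx1K : |T x1| = K := by
    rw [hx1, T.map_smul_univ, smul_eq_mul, abs_mul, Finset.abs_prod]
    simp [hσa, hKdef]
  have hx1e : ∀ i, 0 ≤ inner ℝ (x1 i) e := fun i => by
    simp only [hx1, hσ, real_inner_smul_left]
    split_ifs with h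
    · simpa using h
    · linarith
  have hea : inner ℝ e e = (1 : ℝ) := by
    rw [real_inner_self_eq_norm_sq, he, hx0 a]; norm_num
  have hx1a : inner ℝ (x1 a) e = (1 : ℝ) := by
    have : σ a = 1 := by
      simp only [hσ, ← he, hea]; norm_num
    simp only [hx1, this, one_smul, ← he, hea]
  have hC : IsCompact ({x : ι → E | ∀ i, ‖x i‖ = 1} ∩
      ({x | |T x| = K} ∩ {x | ∀ i, 0 ≤ inner ℝ (x i) e})) := by
    apply hcomp.inter_right
    apply IsClosed.inter
    · exact isClosed_eq (by fun_prop) continuous_const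
    · simp only [Set.ofPred_forall]
      exact isClosed_iInter fun i => isClosed_le continuous_const (by fun_prop)
  obtain ⟨z, ⟨hz1, hz2, hz3⟩, hzmax⟩ := hC.exists_isMaxOn ⟨x1, hx1n, hx1K, hx1e⟩
    (f := fun x => ∑ i, inner ℝ (x i) e) (by fun_prop)
  have hpos : ∃ p, 0 < inner ℝ (z p) e := by
    by_contra! hcon
    have h1 : ∑ i, inner ℝ (x1 i) e ≤ ∑ i, inner ℝ (z i) e := hzmax ⟨hx1n, hx1K, hx1e⟩
    have h2 : ∑ i, inner ℝ (z i) e ≤ 0 := Finset.sum_nonpos fun i _ => hcon i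
    have h3 : inner ℝ (x1 a) e ≤ ∑ i, inner ℝ (x1 i) e :=
      Finset.single_le_sum (fun i _ => hx1e i) (Finset.mem_univ a)
    linarith
  obtain ⟨p, hp⟩ := hpos
  have key : ∀ k, z k = z p := by
    intro k
    by_contra hne
    have hpk : p ≠ k := fun h => hne (by rw [h])
    have hse : 0 < inner ℝ (z p + z k) e := by
      rw [inner_add_left]; linarith [hz3 k]
    have hs : z p + z k ≠ 0 := fun h => by simp [h] at hse
    have hs' : 0 < ‖z p + z k‖ := norm_pos_iff.2 hs
    have hnew := banach_symm_aux T p k hpk (hsym p k hpk) K z hz1 hK hz2 hs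
    set m := ‖z p + z k‖⁻¹ • (z p + z k) with hm
    have hmn : ‖m‖ = 1 := by
      rw [hm, norm_smul, norm_inv, norm_norm]; field_simp
    have hme : inner ℝ m e = ‖z p + z k‖⁻¹ * inner ℝ (z p + z k) e := by
      rw [hm, real_inner_smul_left]
    have hme0 : 0 < inner ℝ m e := by rw [hme]; positivity
    have hval : ∀ i, Function.update (Function.update z p m) k m i =
        if i = k then m else if i = p then m else z i := by
      intro i
      simp [Function.update_apply]
    have hle : ∑ i, inner ℝ (Function.update (Function.update z p m) k m i) e
        ≤ ∑ i, inner ℝ (z i) e := by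
      refine hzmax ⟨fun i => ?_, hnew, fun i => ?_⟩
      · rw [hval]; split_ifs <;> simp [hmn, hz1 i]
      · rw [hval]; split_ifs
        · exact hme0.le
        · exact hme0.le
        · exact hz3 i
    have hdiff : ∑ i, (inner ℝ (Function.update (Function.update z p m) k m i) e
        - inner ℝ (z i) e) = 2 * inner ℝ m e - inner ℝ (z p + z k) e := by
      rw [← Finset.sum_subset (Finset.subset_univ {p, k}), Finset.sum_pair hpk]
      · simp only [hval, if_neg hpk, if_true, inner_add_left]; ring
      · intro i _ hi
        simp only [Finset.mem_insert, Finset.mem_singleton, not_or] at hi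
        simp [hi.1, hi.2]
    rw [Finset.sum_sub_distrib] at hdiff
    have par := parallelogram_law_with_norm ℝ (z p) (z k)
    rw [hz1 p, hz1 k] at par
    have hd : 0 < ‖z p - z k‖ := norm_pos_iff.2 (sub_ne_zero.2 (Ne.symm hne))
    have hlt : ‖z p + z k‖ < 2 := by nlinarith
    have : inner ℝ (z p + z k) e = ‖z p + z k‖ * inner ℝ m e := by
      rw [hme]; field_simp
    nlinarith
  have : z = fun _ => z p := funext key
  have h := hM (z p) (hz1 p)
  rw [← this] at h
  exact hz2 ▸ h

/-- The exponent vector of a multi-index. -/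
noncomputable def expo {d N : ℕ} (i : Fin d → Fin N) : Fin N →₀ ℕ :=
  ∑ k, Finsupp.single (i k) 1

theorem expo_prod {d N : ℕ} (i : Fin d → Fin N) (x : Fin N → ℝ) :
    (expo i).prod (fun j e => x j ^ e) = ∏ k, x (i k) := by
  unfold expo
  rw [← Finsupp.prod_finsetSum_index (by simp) (by intros; rw [pow_add])]
  simp

theorem expo_card {d N : ℕ} (α : Fin N →₀ ℕ) (hα : α.degree = d) :
    (Finset.univ.filter (fun i : Fin d → Fin N => expo i = α)).card = α.multinomial := by
  have h := coeff_sum_X_pow_of_fintype (R := ℤ) α d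
  rw [if_pos (show (α.sum fun _ m => m) = d from hα)] at h
  have h2 : (∑ j : Fin N, (X j : MvPolynomial (Fin N) ℤ)) ^ d
      = ∑ i : Fin d → Fin N, monomial (expo i) 1 := by
    rw [← Fin.prod_const, Finset.prod_univ_sum]
    simp only [Fintype.piFinset_univ]
    refine Finset.sum_congr rfl fun i _ => ?_
    unfold expo
    rw [monomial_sum_one]
    rfl
  rw [h2, coeff_sum] at h
  simp only [coeff_monomial] at h
  rw [← Finset.sum_filter] at h
  simp only [Finset.sum_const, nsmul_eq_mul, mul_one] at h
  exact_mod_cast h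

theorem expo_sum {d N : ℕ} (S : Finset (Fin N →₀ ℕ)) (hS : ∀ α ∈ S, α.degree = d)
    (G : (Fin N →₀ ℕ) → ℝ) (hG : ∀ α ∉ S, G α = 0) (F : (Fin d → Fin N) → ℝ)
    (hF : ∀ i, F i = G (expo i)) :
    ∑ i, F i = ∑ α ∈ S, (α.multinomial : ℝ) * G α := by
  simp only [hF]
  rw [← Finset.sum_filter_add_sum_filter_not Finset.univ (fun i : Fin d → Fin N => expo i ∈ S)]
  rw [Finset.sum_eq_zero (s := Finset.univ.filter (fun i : Fin d → Fin N => ¬ expo i ∈ S))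
    (fun i hi => hG _ (by simpa using hi)), add_zero,
    ← Finset.sum_fiberwise_of_maps_to (t := S) (g := fun i : Fin d → Fin N => expo i)
      (by intro i hi; simpa using hi)]
  refine Finset.sum_congr rfl fun α hα => ?_
  rw [← expo_card α (hS α hα), Finset.filter_filter]
  rw [Finset.sum_congr (g := fun _ => G α) (s₂ := Finset.univ.filter (fun i : Fin d → Fin N => expo i = α))]
  · simp
  · ext i
    simp only [Finset.mem_filter, Finset.mem_univ, true_and]
    exact ⟨fun h => h.2, fun h => ⟨h ▸ hα, h⟩⟩
  · intro i hi
    simp only [Finset.mem_filter, Finset.mem_univ, true_and] at hi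
    rw [hi]

/-- The symmetric tensor attached to a form. -/
noncomputable def tens {n : ℕ} (d : ℕ) (f : MvPolynomial (Fin (n + 1)) ℝ)
    (i : Fin d → Fin (n + 1)) : ℝ :=
  ((expo i).multinomial : ℝ)⁻¹ * coeff (expo i) f

noncomputable def tensMap {n : ℕ} (d : ℕ) (f : MvPolynomial (Fin (n + 1)) ℝ) :
    MultilinearMap ℝ (fun _ : Fin d => EuclideanSpace ℝ (Fin (n + 1))) ℝ :=
  ∑ i : Fin d → Fin (n + 1), tens d f i •
    (MultilinearMap.mkPiAlgebra ℝ (Fin d) ℝ).compLinearMap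
      (fun k => (EuclideanSpace.proj (i k) : EuclideanSpace ℝ (Fin (n + 1)) →L[ℝ] ℝ).toLinearMap)

theorem tensMap_apply {n : ℕ} (d : ℕ) (f : MvPolynomial (Fin (n + 1)) ℝ)
    (x : Fin d → EuclideanSpace ℝ (Fin (n + 1))) :
    tensMap d f x = ∑ i : Fin d → Fin (n + 1), tens d f i * ∏ k, x k (i k) := by
  simp [tensMap]

theorem multinomial_ne {N : ℕ} (α : Fin N →₀ ℕ) : (α.multinomial : ℝ) ≠ 0 := by
  have : 0 < α.multinomial := Nat.multinomial_pos _ _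
  exact_mod_cast this.ne'

theorem deg_supp {n d : ℕ} {f : MvPolynomial (Fin (n + 1)) ℝ} (hf : f.IsHomogeneous d) :
    ∀ α ∈ f.support, α.degree = d := by
  intro α hα
  by_contra h
  exact (mem_support_iff.1 hα) (hf.coeff_eq_zero h)

theorem tens_eval {n d : ℕ} {f : MvPolynomial (Fin (n + 1)) ℝ} (hf : f.IsHomogeneous d)
    (x : Fin (n + 1) → ℝ) :
    ∑ i : Fin d → Fin (n + 1), tens d f i * ∏ k, x (i k) = eval x f := by
  rw [expo_sum f.support (deg_supp hf)
    (fun α => (α.multinomial : ℝ)⁻¹ * coeff α f * α.prod (fun j e => x j ^ e)) ?_ _ ?_, eval_eq]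
  · refine Finset.sum_congr rfl fun α _ => ?_
    have := multinomial_ne α
    simp only [Finsupp.prod]
    field_simp
  · intro α hα
    simp [notMem_support_iff.1 hα]
  · intro i
    simp only [expo_prod, tens]

theorem tens_weyl {n d : ℕ} {f : MvPolynomial (Fin (n + 1)) ℝ} (hf : f.IsHomogeneous d) :
    ∑ i : Fin d → Fin (n + 1), tens d f i ^ 2 = weylNormSq f := by
  rw [expo_sum f.support (deg_supp hf)
    (fun α => ((α.multinomial : ℝ)⁻¹ * coeff α f) ^ 2) ?_ _ ?_, weylNormSq]
  · refine Finset.sum_congr rfl fun α _ => ?_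
    have := multinomial_ne α
    field_simp
  · intro α hα
    simp [notMem_support_iff.1 hα]
  · intro i
    rfl

theorem expo_perm {d N : ℕ} (i : Fin d → Fin N) (σ : Equiv.Perm (Fin d)) :
    expo (i ∘ σ) = expo i := by
  unfold expo
  exact Equiv.sum_comp σ (fun k => Finsupp.single (i k) 1)

theorem tensMap_perm {n : ℕ} (d : ℕ) (f : MvPolynomial (Fin (n + 1)) ℝ)
    (x : Fin d → EuclideanSpace ℝ (Fin (n + 1))) (σ : Equiv.Perm (Fin d)) :
    tensMap d f (x ∘ σ) = tensMap d f x := by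
  rw [tensMap_apply, tensMap_apply]
  rw [← Equiv.sum_comp (Equiv.arrowCongr σ (Equiv.refl (Fin (n + 1)))).symm]
  refine Finset.sum_congr rfl fun i _ => ?_
  have h : (Equiv.arrowCongr σ (Equiv.refl (Fin (n + 1)))).symm i = i ∘ σ := by
    ext; simp [Equiv.arrowCongr]
  rw [h, tens, tens, expo_perm]
  congr 1
  exact Equiv.prod_comp σ (fun k => x k (i k))

theorem abs_eval_le {n d : ℕ} {f : MvPolynomial (Fin (n + 1)) ℝ} (hf : f.IsHomogeneous d)
    (x : Fin (n + 1) → ℝ) (hx : vnorm x = 1) : |eval x f| ≤ Real.sqrt (weylNormSq f) := by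
  apply Real.abs_le_sqrt
  rw [← tens_eval hf, ← tens_weyl hf]
  refine (Finset.sum_mul_sq_le_sq_mul_sq _ _ _).trans (le_of_eq ?_)
  have h1 : ∑ j, x j ^ 2 = 1 := by
    rw [vnorm, Real.sqrt_eq_one] at hx; exact hx
  have h2 : ∑ i : Fin d → Fin (n + 1), (∏ k, x (i k)) ^ 2 = 1 := by
    have : (∑ j, x j ^ 2) ^ d = ∑ i : Fin d → Fin (n + 1), ∏ k, x (i k) ^ 2 := by
      rw [← Fin.prod_const, Finset.prod_univ_sum]
      simp only [Fintype.piFinset_univ]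
    simp only [← Finset.prod_pow]
    rw [← this, h1, one_pow]
  rw [h2, mul_one]

/-- Proposition 2.11, real part with `q = 1`:
`‖f‖∞ ≤ ‖f‖_W ≤ (n+1)^{d/2} ‖f‖∞`. -/
theorem supNorm_weyl_comparison (n d : ℕ) (hn : 1 ≤ n) (hd : 1 ≤ d)
    (f : MvPolynomial (Fin (n + 1)) ℝ) (hf : f.IsHomogeneous d) :
    polySupNorm1 f ≤ Real.sqrt (weylNormSq f) ∧
    Real.sqrt (weylNormSq f) ≤ ((n : ℝ) + 1) ^ ((d : ℝ) / 2) * polySupNorm1 f := by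
  constructor
  · exact Real.iSup_le (fun x => abs_eval_le hf x.1 x.2) (Real.sqrt_nonneg _)
  · have hM0 : 0 ≤ polySupNorm1 f := Real.iSup_nonneg fun x => abs_nonneg _
    have hbdd : BddAbove (Set.range fun x : {x : Fin (n + 1) → ℝ // vnorm x = 1} =>
        |eval x.1 f|) := by
      refine ⟨Real.sqrt (weylNormSq f), ?_⟩
      rintro _ ⟨x, rfl⟩
      exact abs_eval_le hf x.1 x.2
    have hent : ∀ i, |tens d f i| ≤ polySupNorm1 f := by
      intro i
      have h := banach_symm (tensMap d f) ?_ (⟨0, hd⟩ : Fin d) ?_ (polySupNorm1 f) ?_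
        (fun k => EuclideanSpace.single (i k) (1 : ℝ)) (by intro k; simp)
      · rw [tensMap_apply, Finset.sum_eq_single i] at h
        · simpa using h
        · intro j _ hj
          obtain ⟨k, hk⟩ := Function.ne_iff.1 hj
          rw [Finset.prod_eq_zero (Finset.mem_univ k), mul_zero]
          simp [hk]
        · simp
      · have : (tensMap d f : _ → ℝ) = fun x => ∑ i : Fin d → Fin (n + 1),
          tens d f i * ∏ k, x k (i k) := funext (tensMap_apply d f)
        rw [this]
        fun_prop
      · intro p k hpk x u w
        rw [← tensMap_perm d f _ (Equiv.swap p k)]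
        congr 1
        ext1 j
        by_cases h1 : j = p
        · subst h1; simp [Function.update_apply, hpk]
        · by_cases h2 : j = k
          · subst h2; simp [Function.update_apply, hpk]
          · simp [Equiv.swap_apply_of_ne_of_ne h1 h2, h1, h2]
      · intro y hy
        rw [tensMap_apply, tens_eval hf (fun j => y j)]
        have hy' : vnorm (fun j => y j) = 1 := by
          rw [EuclideanSpace.norm_eq] at hy
          simpa [vnorm] using hy
        exact le_ciSup hbdd ⟨fun j => y j, hy'⟩
    have hw : weylNormSq f ≤ ((n : ℝ) + 1) ^ d * polySupNorm1 f ^ 2 := by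
      rw [← tens_weyl hf]
      refine (Finset.sum_le_sum (fun i _ => sq_le_sq' (neg_le_of_abs_le (hent i))
        (le_of_abs_le (hent i)))).trans (le_of_eq ?_)
      simp
    refine (Real.sqrt_le_sqrt hw).trans (le_of_eq ?_)
    have hn0 : (0 : ℝ) ≤ (n : ℝ) + 1 := by positivity
    rw [Real.sqrt_mul (by positivity), Real.sqrt_sq hM0, Real.sqrt_eq_rpow, ← Real.rpow_natCast,
      ← Real.rpow_mul hn0]
    congr 2
    ring
end
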